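/- Let A, B ∈ ℝ^{n×n} with decompositions A = D_A − L_A − U_A and B = D_B − L_B − U_B into diagonal, strictly lower triangular, and strictly upper triangular parts, and let b ∈ ℝ^n. Assume A_{ii} > |B_{ii}| for all i and that ⟨A⟩ − |B| is an M-matrix. Let (x^{(k)})_{k≥0} be any sequence in ℝ^n satisfying the GGS iteration (D_A − L_A)x^{(k+1)} − (D_B − L_B)|x^{(k+1)}| = U_A x^{(k)} − U_B |x^{(k)}| + b for all k ≥ 0. Then (x^{(k)}) converges to a vector x* ∈ ℝ^n satisfying A x* − B |x*| = b, and x* is the unique solution of this equation. -/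

import Mathlib

open Matrix Filter

/-- Entrywise absolute value of a matrix. -/
def matAbs {n : ℕ} (M : Matrix (Fin n) (Fin n) ℝ) : Matrix (Fin n) (Fin n) ℝ :=
  Matrix.of fun i j => |M i j|

/-- The comparison matrix `⟨A⟩`: `⟨A⟩_{ii} = |A_{ii}|`, `⟨A⟩_{ij} = −|A_{ij}|` for `i ≠ j`. -/
def compMat {n : ℕ} (A : Matrix (Fin n) (Fin n) ℝ) : Matrix (Fin n) (Fin n) ℝ :=
  Matrix.of fun i j => if i = j then |A i j| else -|A i j|

/-- An M-matrix: a Z-matrix which is invertible with entrywise nonnegative inverse. -/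
def IsMMatrix {n : ℕ} (M : Matrix (Fin n) (Fin n) ℝ) : Prop :=
  (∀ i j : Fin n, i ≠ j → M i j ≤ 0) ∧ IsUnit M ∧ ∀ i j : Fin n, 0 ≤ M⁻¹ i j

/-- One Gauss–Seidel sweep contracts the `v`-weighted sup norm by the factor `ρ`. -/
theorem gaussSeidel_sweep_le {n : ℕ} {p q : Fin n → ℝ} {L L' U U' : Matrix (Fin n) (Fin n) ℝ}
    {v : Fin n → ℝ} {ρ c : ℝ} (hL : ∀ i j, ¬ j < i → L i j = 0)
    (hL' : ∀ i j, ¬ j < i → L' i j = 0) (hpq : ∀ i, |q i| < p i) (hv : ∀ i, 0 < v i)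
    (hρ : ρ < 1) (hc : 0 ≤ c)
    (hN : ∀ i, ∑ j, (|L i j| + |L' i j| + |U i j| + |U' i j|) * v j ≤ ρ * ((p i - |q i|) * v i))
    {x y x' y' : Fin n → ℝ}
    (heq : ∀ i, p i * (x' i - y' i) - q i * (|x' i| - |y' i|) =
      ∑ j, (L i j * (x' j - y' j) - L' i j * (|x' j| - |y' j|) +
        (U i j * (x j - y j) - U' i j * (|x j| - |y j|))))
    (hxy : ∀ j, |x j - y j| ≤ c * v j) (i : Fin n) : |x' i - y' i| ≤ ρ * c * v i := by
  induction i using WellFoundedLT.induction with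
  | ind i ih =>
  have term_le (a a' s t w : ℝ) (h : |s - t| ≤ w) :
      |a * (s - t) - a' * (|s| - |t|)| ≤ (|a| + |a'|) * w := by
    refine (abs_sub _ _).trans ?_
    rw [abs_mul, abs_mul, add_mul]
    gcongr
    exact (abs_abs_sub_abs_le s t).trans h
  have hR : |∑ j, (L i j * (x' j - y' j) - L' i j * (|x' j| - |y' j|) +
        (U i j * (x j - y j) - U' i j * (|x j| - |y j|)))| ≤
      c * ∑ j, (|L i j| + |L' i j| + |U i j| + |U' i j|) * v j := by
    rw [Finset.mul_sum]
    refine (Finset.abs_sum_le_sum_abs _ _).trans (Finset.sum_le_sum fun j _ => ?_)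
    have hU := term_le (U i j) (U' i j) _ _ _ (hxy j)
    have hLow : |L i j * (x' j - y' j) - L' i j * (|x' j| - |y' j|)| ≤
        (|L i j| + |L' i j|) * (c * v j) := by
      by_cases hj : j < i
      · refine term_le _ _ _ _ _ ((ih j hj).trans ?_)
        nlinarith [mul_nonneg hc (hv j).le]
      · simp [hL i j hj, hL' i j hj]
    calc _ ≤ _ := abs_add_le _ _
      _ ≤ _ := add_le_add hLow hU
      _ = _ := by ring
  have hlow : (p i - |q i|) * |x' i - y' i| ≤
      |p i * (x' i - y' i) - q i * (|x' i| - |y' i|)| := by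
    have h1 := abs_sub_abs_le_abs_sub (p i * (x' i - y' i)) (q i * (|x' i| - |y' i|))
    rw [abs_mul, abs_mul, abs_of_pos ((abs_nonneg _).trans_lt (hpq i))] at h1
    have h2 := mul_le_mul_of_nonneg_left (abs_abs_sub_abs_le (x' i) (y' i)) (abs_nonneg (q i))
    linarith
  rw [heq i] at hlow
  refine le_of_mul_le_mul_left ?_ (sub_pos.2 (hpq i))
  calc _ ≤ _ := hlow.trans hR
    _ ≤ c * (ρ * ((p i - |q i|) * v i)) := mul_le_mul_of_nonneg_left (hN i) hc
    _ = _ := by ring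

/-- An M-matrix maps some entrywise positive vector to the all-ones vector. -/
theorem IsMMatrix.exists_pos_mulVec_eq_one {n : ℕ} {M : Matrix (Fin n) (Fin n) ℝ}
    (hM : IsMMatrix M) :
    ∃ v : Fin n → ℝ, (∀ i, 0 < v i) ∧ M *ᵥ v = 1 := by
  obtain ⟨hZ, hU, hinv⟩ := hM
  have hv0 (i : Fin n) : 0 ≤ (M⁻¹ *ᵥ 1) i := by
    simpa [mulVec, dotProduct] using Finset.sum_nonneg fun j _ => hinv i j
  have h1 : M *ᵥ (M⁻¹ *ᵥ 1) = 1 := by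
    rw [mulVec_mulVec, mul_nonsing_inv _ ((isUnit_iff_isUnit_det _).1 hU), one_mulVec]
  refine ⟨M⁻¹ *ᵥ 1, fun i => ?_, h1⟩
  refine (hv0 i).lt_of_ne fun h => ?_
  have : (M *ᵥ (M⁻¹ *ᵥ 1)) i ≤ 0 := by
    rw [mulVec, dotProduct]
    refine Finset.sum_nonpos fun j _ => ?_
    rcases eq_or_ne i j with rfl | hij
    · rw [← h, mul_zero]
    · exact mul_nonpos_of_nonpos_of_nonneg (hZ i j hij) (hv0 j)
  rw [h1] at this
  exact absurd this (by simp)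

/-- A vector is bounded entrywise by a multiple of a positive vector. -/
theorem exists_abs_le_mul_of_pos {n : ℕ} {v : Fin n → ℝ} (hv : ∀ i, 0 < v i) (d : Fin n → ℝ) :
    ∃ c, 0 ≤ c ∧ ∀ i, |d i| ≤ c * v i := by
  have hnn (j : Fin n) : 0 ≤ |d j| / v j := div_nonneg (abs_nonneg _) (hv j).le
  refine ⟨∑ j, |d j| / v j, Finset.sum_nonneg fun j _ => hnn j, fun i => ?_⟩
  rw [← div_le_iff₀ (hv i)]
  exact Finset.single_le_sum (fun j _ => hnn j) (Finset.mem_univ i)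

/-- A sequence whose successive differences contract in the `v`-weighted sup norm converges. -/
theorem exists_tendsto_of_weighted_contraction {n : ℕ} {v : Fin n → ℝ} {ρ : ℝ}
    (hv : ∀ i, 0 < v i) (hρ0 : 0 ≤ ρ) (hρ : ρ < 1) (x : ℕ → Fin n → ℝ)
    (hx : ∀ k c, 0 ≤ c → (∀ i, |x (k + 1) i - x k i| ≤ c * v i) →
      ∀ i, |x (k + 2) i - x (k + 1) i| ≤ ρ * c * v i) :
    ∃ a, Tendsto x atTop (nhds a) := by
  obtain ⟨c, hc, hcv⟩ := exists_abs_le_mul_of_pos hv (x 1 - x 0)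
  have hk (k : ℕ) : ∀ i, |x (k + 1) i - x k i| ≤ ρ ^ k * c * v i := by
    induction k with
    | zero => simpa using hcv
    | succ k ih =>
      intro i
      have := hx k _ (by positivity) ih i
      rwa [← mul_assoc, ← pow_succ'] at this
  have hlim (i : Fin n) : ∃ a, Tendsto (fun k => x k i) atTop (nhds a) := by
    refine cauchySeq_tendsto_of_complete (cauchySeq_of_le_geometric ρ (c * v i) hρ fun k => ?_)
    rw [dist_comm, Real.dist_eq]
    linarith [hk k i]
  choose a ha using hlim
  exact ⟨a, tendsto_pi_nhds.2 ha⟩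

/-- Theorem 3.2: if `A_{ii} > |B_{ii}|` and `⟨A⟩ − |B|` is an M-matrix, any sequence
generated by the GGS iteration converges to the unique solution of the GAVE. -/
theorem ggs_convergence_of_Mmatrix {n : ℕ}
    (A B DA LA UA DB LB UB : Matrix (Fin n) (Fin n) ℝ)
    (hDA : ∀ i j : Fin n, i ≠ j → DA i j = 0)
    (hLA : ∀ i j : Fin n, ¬ j < i → LA i j = 0)
    (hUA : ∀ i j : Fin n, ¬ i < j → UA i j = 0)
    (hA : A = DA - LA - UA)
    (hDB : ∀ i j : Fin n, i ≠ j → DB i j = 0)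
    (hLB : ∀ i j : Fin n, ¬ j < i → LB i j = 0)
    (hUB : ∀ i j : Fin n, ¬ i < j → UB i j = 0)
    (hB : B = DB - LB - UB)
    (hdiag : ∀ i : Fin n, A i i > |B i i|)
    (hM : IsMMatrix (compMat A - matAbs B))
    (b : Fin n → ℝ) (x : ℕ → Fin n → ℝ)
    (hiter : ∀ k : ℕ,
      (DA - LA).mulVec (x (k + 1)) - (DB - LB).mulVec (fun i => |x (k + 1) i|) =
        UA.mulVec (x k) - UB.mulVec (fun i => |x k i|) + b) :
    ∃ xstar : Fin n → ℝ,
      Tendsto x atTop (nhds xstar) ∧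
      A.mulVec xstar - B.mulVec (fun i => |xstar i|) = b ∧
      ∀ y : Fin n → ℝ, A.mulVec y - B.mulVec (fun i => |y i|) = b → y = xstar := by
  have hAii (i : Fin n) : A i i = DA i i := by
    simp [hA, hLA i i (lt_irrefl i), hUA i i (lt_irrefl i)]
  have hBii (i : Fin n) : B i i = DB i i := by
    simp [hB, hLB i i (lt_irrefl i), hUB i i (lt_irrefl i)]
  have hpq (i : Fin n) : |DB i i| < DA i i := by rw [← hAii, ← hBii]; exact hdiag i
  have hMij (i j : Fin n) : (compMat A - matAbs B) i j =
      (if i = j then DA i i - |DB i i| else 0) -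
        (|LA i j| + |LB i j| + |UA i j| + |UB i j|) := by
    rcases lt_trichotomy i j with h | rfl | h
    · simp [compMat, matAbs, hA, hB, h.ne, hDA i j h.ne, hDB i j h.ne, hLA i j h.not_gt,
        hLB i j h.not_gt]
      ring
    · simp [compMat, matAbs, hAii, hBii, hLA i i (lt_irrefl i), hUA i i (lt_irrefl i),
        hLB i i (lt_irrefl i), hUB i i (lt_irrefl i), abs_of_pos ((abs_nonneg _).trans_lt (hpq i))]
    · simp [compMat, matAbs, hA, hB, h.ne', hDA i j h.ne', hDB i j h.ne', hUA i j h.not_gt,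
        hUB i j h.not_gt]
      ring
  obtain ⟨v, hv, hMv⟩ := hM.exists_pos_mulVec_eq_one
  have hrow (i : Fin n) : (DA i i - |DB i i|) * v i -
      ∑ j, (|LA i j| + |LB i j| + |UA i j| + |UB i j|) * v j = 1 := by
    have := congrFun hMv i
    simpa [mulVec, dotProduct, hMij, sub_mul, Finset.sum_sub_distrib, ite_mul] using this
  have hnn (i : Fin n) : 0 ≤ (DA i i - |DB i i|) * v i :=
    mul_nonneg (sub_pos.2 (hpq i)).le (hv i).le
  obtain ⟨ρ, hρ0, hρ1, hN⟩ : ∃ ρ : ℝ, 0 ≤ ρ ∧ ρ < 1 ∧ ∀ i,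
      ∑ j, (|LA i j| + |LB i j| + |UA i j| + |UB i j|) * v j ≤
        ρ * ((DA i i - |DB i i|) * v i) := by
    set S := 1 + ∑ i, (DA i i - |DB i i|) * v i with hS
    have hsum : 0 ≤ ∑ i, (DA i i - |DB i i|) * v i := Finset.sum_nonneg fun i _ => hnn i
    have hS1 : 1 ≤ S := by linarith
    have hS0 : 0 < S := by linarith
    refine ⟨1 - 1 / S, ?_, ?_, fun i => ?_⟩
    · rw [sub_nonneg, div_le_one hS0]; exact hS1
    · linarith [one_div_pos.2 hS0]
    · have h1 : (DA i i - |DB i i|) * v i ≤ S := by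
        have := Finset.single_le_sum (fun j _ => hnn j) (Finset.mem_univ i)
        linarith
      have h2 : 1 / S * ((DA i i - |DB i i|) * v i) ≤ 1 := by
        rw [one_div_mul_eq_div, div_le_one hS0]; exact h1
      linarith [hrow i]
  have hdiagMul {D : Matrix (Fin n) (Fin n) ℝ} (hD : ∀ i j, i ≠ j → D i j = 0)
      (z : Fin n → ℝ) (i : Fin n) : (D *ᵥ z) i = D i i * z i := by
    rw [mulVec, dotProduct]
    exact Finset.sum_eq_single i (fun j _ hj => by simp [hD i j hj.symm]) (by simp)
  have hcontr {x y x' y' : Fin n → ℝ} {c : ℝ}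
      (h : (DA - LA) *ᵥ x' - (DB - LB) *ᵥ (fun i => |x' i|) =
        UA *ᵥ x - UB *ᵥ (fun i => |x i|) + b)
      (h' : (DA - LA) *ᵥ y' - (DB - LB) *ᵥ (fun i => |y' i|) =
        UA *ᵥ y - UB *ᵥ (fun i => |y i|) + b)
      (hc : 0 ≤ c) (hxy : ∀ j, |x j - y j| ≤ c * v j) (i : Fin n) :
      |x' i - y' i| ≤ ρ * c * v i := by
    refine gaussSeidel_sweep_le hLA hLB hpq hv hρ1 hc hN (fun i => ?_) hxy i
    have h1 := congrFun h i
    have h2 := congrFun h' i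
    simp only [sub_mulVec, Pi.sub_apply, Pi.add_apply, hdiagMul hDA, hdiagMul hDB] at h1 h2
    simp only [mulVec, dotProduct] at h1 h2
    simp only [mul_sub, Finset.sum_add_distrib, Finset.sum_sub_distrib]
    linarith
  have hfix (y : Fin n → ℝ) : A *ᵥ y - B *ᵥ (fun i => |y i|) = b ↔
      (DA - LA) *ᵥ y - (DB - LB) *ᵥ (fun i => |y i|) =
        UA *ᵥ y - UB *ᵥ (fun i => |y i|) + b := by
    rw [hA, hB, sub_mulVec (DA - LA), sub_mulVec (DB - LB), ← sub_eq_iff_eq_add']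
    constructor <;> intro h <;> rw [← h] <;> abel
  obtain ⟨xstar, hlim⟩ := exists_tendsto_of_weighted_contraction hv hρ0 hρ1 x
    fun k c hc hk => hcontr (hiter (k + 1)) (hiter k) hc hk
  have hstar : (DA - LA) *ᵥ xstar - (DB - LB) *ᵥ (fun i => |xstar i|) =
      UA *ᵥ xstar - UB *ᵥ (fun i => |xstar i|) + b := by
    have hcont (P Q : Matrix (Fin n) (Fin n) ℝ) :
        Continuous fun z : Fin n → ℝ => P *ᵥ z - Q *ᵥ (fun i => |z i|) := by fun_prop
    have h1 := ((hcont (DA - LA) (DB - LB)).tendsto xstar).comp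
      (hlim.comp (tendsto_add_atTop_nat 1))
    have h2 := (((hcont UA UB).tendsto xstar).comp hlim).add_const b
    exact tendsto_nhds_unique (h1.congr hiter) h2
  refine ⟨xstar, hlim, (hfix xstar).2 hstar, fun y hy => ?_⟩
  obtain ⟨c, hc, hcv⟩ := exists_abs_le_mul_of_pos hv (y - xstar)
  have hk (k : ℕ) : ∀ i, |y i - xstar i| ≤ ρ ^ k * c * v i := by
    induction k with
    | zero => simpa using hcv
    | succ k ih =>
      intro i
      have := hcontr ((hfix y).1 hy) hstar (by positivity) ih i
      rwa [← mul_assoc, ← pow_succ'] at this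
  funext i
  have h0 : Tendsto (fun k : ℕ => ρ ^ k * c * v i) atTop (nhds 0) := by
    simpa using ((tendsto_pow_atTop_nhds_zero_of_lt_one hρ0 hρ1).mul_const c).mul_const (v i)
  exact sub_eq_zero.1 (abs_nonpos_iff.1 (ge_of_tendsto' h0 fun k => hk k i))
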